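/- arXiv:1810.03565 — 2 statements merged into one kernel-verified Lean document; each statement's English description precedes it below -/
import Mathlib

section
/- Let n ≥ 1 and 1 ≤ k < n be integers and let a₁, …, a_n be nonnegative integers with a₁+⋯+a_n = n−k. Then the number of simple graphs G on the vertex set {1,…,n} that are acyclic, in which the vertices 1, …, k lie in pairwise distinct connected components, and whose degrees satisfy deg_G(i) = a_i for 1 ≤ i ≤ k and deg_G(i) = a_i + 1 for k+1 ≤ i ≤ n, equals the sum over those l ∈ {1,…,k} with a_l ≥ 1 of the multinomial coefficient (n−k−1)! / ( (a_l − 1)! · ∏_{i ≠ l} a_i! ). -/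
open Finset Nat in
/-- Removing one unit from entry `u` multiplies the multinomial coefficient by `a u / ∑ a`. -/
theorem Nat.sum_mul_multinomial_update_pred {V : Type*} [Fintype V] [DecidableEq V]
    (a : V → ℕ) (u : V) (hu : 1 ≤ a u) :
    (∑ i, a i) * Nat.multinomial univ (Function.update a u (a u - 1)) =
      a u * Nat.multinomial univ a := by
  set b := Function.update a u (a u - 1)
  have hb : ∏ i ∈ univ.erase u, (b i)! = ∏ i ∈ univ.erase u, (a i)! :=
    prod_congr rfl fun i hi => by simp [b, ne_of_mem_erase hi]
  have hb' : ∑ i ∈ univ.erase u, b i = ∑ i ∈ univ.erase u, a i :=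
    sum_congr rfl fun i hi => by simp [b, ne_of_mem_erase hi]
  have ea := Nat.multinomial_spec univ a
  have eb := Nat.multinomial_spec univ b
  rw [← mul_prod_erase _ _ (mem_univ u), ← add_sum_erase _ _ (mem_univ u)] at ea eb
  rw [← add_sum_erase _ _ (mem_univ u)]
  have hbu : b u = a u - 1 := by simp [b]
  rw [hb, hb', hbu] at eb
  obtain ⟨m, hm⟩ : ∃ m, a u = m + 1 := ⟨a u - 1, by omega⟩
  rw [hm] at ea eb ⊢
  simp only [Nat.add_sub_cancel] at eb
  rw [show m + 1 + ∑ i ∈ univ.erase u, a i = (m + ∑ i ∈ univ.erase u, a i) + 1 by ring,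
    Nat.factorial_succ, Nat.factorial_succ, ← eb] at ea
  rw [show m + 1 + ∑ i ∈ univ.erase u, a i = (m + ∑ i ∈ univ.erase u, a i) + 1 by ring]
  have hpos : 0 < m ! * ∏ i ∈ univ.erase u, (a i)! :=
    Nat.mul_pos (Nat.factorial_pos _) (prod_pos fun i _ => Nat.factorial_pos _)
  apply Nat.eq_of_mul_eq_mul_left hpos
  linarith

open Finset in
/-- Pascal's recurrence for multinomial coefficients. -/
theorem Nat.multinomial_eq_sum_update_pred {V : Type*} [Fintype V] [DecidableEq V]
    (a : V → ℕ) (ha : ∑ i, a i ≠ 0) :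
    Nat.multinomial univ a =
      ∑ u with 1 ≤ a u, Nat.multinomial univ (Function.update a u (a u - 1)) := by
  apply Nat.eq_of_mul_eq_mul_left (Nat.pos_of_ne_zero ha)
  rw [mul_sum, sum_congr rfl fun u hu =>
    Nat.sum_mul_multinomial_update_pred a u (mem_filter.1 hu).2, ← sum_mul]
  congr 1
  rw [sum_filter]
  exact sum_congr rfl fun i _ => by split_ifs <;> omega

namespace SimpleGraph

variable {V : Type*}

open Finset in
/-- An acyclic graph has at least as many missing edges, compared with the number of vertices,
as it has pairwise unreachable vertices. -/
theorem IsAcyclic.ncard_edgeSet_add_card_le [Fintype V] [DecidableEq V] {G : SimpleGraph V}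
    (hG : G.IsAcyclic) (T : Finset V)
    (hT : ∀ i ∈ T, ∀ j ∈ T, i ≠ j → ¬ G.Reachable i j) :
    G.edgeSet.ncard + #T ≤ Fintype.card V := by
  induction hm : G.edgeSet.ncard generalizing G T with
  | zero => simpa using T.card_le_univ
  | succ m ih =>
    obtain ⟨e, he⟩ := (Set.ncard_pos (s := G.edgeSet)).1 (by omega)
    induction e with | h x y
    set H := G.deleteEdges {s(x, y)}
    have hHG : H ≤ G := G.deleteEdges_le _
    have hxy : ¬ H.Reachable x y :=
      isBridge_iff.1 (isAcyclic_iff_forall_isBridge.1 hG he)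
    have hcard : H.edgeSet.ncard = m := by
      rw [edgeSet_deleteEdges, Set.ncard_sdiff_singleton_of_mem he, hm]; rfl
    have hadj : G.Reachable x y := Adj.reachable he
    obtain ⟨z, hz⟩ : ∃ z, ∀ t ∈ T, ¬ H.Reachable z t := by
      by_contra! h
      obtain ⟨s, hs, hxs⟩ := h x
      obtain ⟨t, ht, hyt⟩ := h y
      by_cases hst : s = t
      · exact hxy (hxs.trans (hst ▸ hyt.symm))
      · exact hT s hs t ht hst ((hxs.mono hHG).symm.trans (hadj.trans (hyt.mono hHG)))
    have hzT : z ∉ T := fun h => hz z h .rfl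
    have key := ih (G := H) (hG.anti hHG) (insert z T) (by
      intro i hi j hj hij
      rw [mem_insert] at hi hj
      rcases hi with rfl | hi <;> rcases hj with rfl | hj
      · exact absurd rfl hij
      · exact hz j hj
      · exact fun h => hz i hi h.symm
      · exact fun h => hT i hi j hj hij (h.mono hHG)) hcard
    rw [card_insert_of_notMem hzT] at key
    omega

/-- `G` is a forest whose vertices outside `S` lie in distinct components and whose number of
children at each vertex is prescribed by `a`, when the vertices outside `S` are taken as roots. -/
structure IsRootedForest (S : Finset V) (a : V → ℕ) (G : SimpleGraph V) : Prop where
  isAcyclic : G.IsAcyclic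
  not_reachable : ∀ ⦃i j⦄, i ∉ S → j ∉ S → i ≠ j → ¬ G.Reachable i j
  ncard_of_notMem : ∀ ⦃i⦄, i ∉ S → (G.neighborSet i).ncard = a i
  ncard_of_mem : ∀ ⦃i⦄, i ∈ S → (G.neighborSet i).ncard = a i + 1

/-- A set of vertices closed under adjacency is closed under reachability. -/
theorem Reachable.mem_of_forall_adj {G : SimpleGraph V} {s : Set V}
    (hs : ∀ x ∈ s, ∀ y, G.Adj x y → y ∈ s) {x y : V} (h : G.Reachable x y) (hx : x ∈ s) :
    y ∈ s := by
  obtain ⟨p⟩ := h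
  induction p with
  | nil => exact hx
  | cons hadj _ ih => exact ih (hs _ hx _ hadj)

section

variable {H : SimpleGraph V} {u v : V}

theorem neighborSet_sup_edge_right (huv : u ≠ v) :
    (H ⊔ edge v u).neighborSet u = insert v (H.neighborSet u) := by
  ext x
  simp only [mem_neighborSet, sup_adj, edge_adj, Set.mem_insert_iff]
  grind

theorem neighborSet_sup_edge_left (huv : u ≠ v) :
    (H ⊔ edge v u).neighborSet v = insert u (H.neighborSet v) := by
  ext x
  simp only [mem_neighborSet, sup_adj, edge_adj, Set.mem_insert_iff]
  grind

theorem neighborSet_sup_edge_of_ne {x : V} (hu : x ≠ u) (hv : x ≠ v) :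
    (H ⊔ edge v u).neighborSet x = H.neighborSet x := by
  ext y
  simp only [mem_neighborSet, sup_adj, edge_adj]
  grind

theorem not_reachable_of_forall_not_adj (hv : ∀ x, ¬ H.Adj v x) {x : V} (hx : x ≠ v) :
    ¬ H.Reachable v x := fun h =>
  hx (h.mem_of_forall_adj (s := {v}) (by rintro _ rfl y hy; exact absurd hy (hv y)) rfl)

/-- Attaching a pendant vertex does not change reachability between the other vertices. -/
theorem Reachable.of_sup_edge (hv : ∀ x, ¬ H.Adj v x) {x y : V}
    (h : (H ⊔ edge v u).Reachable x y) (hx : x ≠ v) (hy : y ≠ v) : H.Reachable x y := by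
  have key := h.mem_of_forall_adj (s := {z | (z ≠ v → H.Reachable x z) ∧ (z = v → H.Reachable x u)})
    (by
      rintro z ⟨hz, hz'⟩ w hzw
      rw [sup_adj, edge_adj] at hzw
      rcases hzw with hzw | ⟨⟨rfl, rfl⟩ | ⟨rfl, rfl⟩, hne⟩
      · have hzv : z ≠ v := by rintro rfl; exact hv _ hzw
        exact ⟨fun _ => (hz hzv).trans hzw.reachable,
          by rintro rfl; exact absurd hzw.symm (hv _)⟩
      · exact ⟨fun _ => hz' rfl, fun h => absurd h.symm hne⟩
      · exact ⟨fun h => absurd rfl h, fun _ => hz hne⟩)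
    ⟨fun _ => .rfl, fun h => absurd h hx⟩
  exact key.1 hy

theorem isRootedForest_sup_edge_iff [Finite V] [DecidableEq V] {S : Finset V} {a : V → ℕ}
    (hv : ∀ x, ¬ H.Adj v x) (hvS : v ∈ S) (hav : a v = 0) (hau : 1 ≤ a u) :
    IsRootedForest S a (H ⊔ edge v u) ↔
      IsRootedForest (S.erase v) (Function.update a u (a u - 1)) H := by
  have huv : u ≠ v := by rintro rfl; omega
  have hN : H.neighborSet v = ∅ := Set.eq_empty_of_forall_notMem hv
  have hcu : ((H ⊔ edge v u).neighborSet u).ncard = (H.neighborSet u).ncard + 1 := by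
    rw [neighborSet_sup_edge_right huv, Set.ncard_insert_of_notMem
      (show v ∉ H.neighborSet u from fun h => hv u (Adj.symm h))]
  have hcv : ((H ⊔ edge v u).neighborSet v).ncard = 1 := by
    simp [neighborSet_sup_edge_left huv, hN]
  have hHv : (H.neighborSet v).ncard = 0 := by simp [hN]
  have hcx : ∀ x, x ≠ u → x ≠ v →
      ((H ⊔ edge v u).neighborSet x).ncard = (H.neighborSet x).ncard := fun x h₁ h₂ => by
    rw [neighborSet_sup_edge_of_ne h₁ h₂]
  constructor
  · rintro ⟨h₁, h₂, h₃, h₄⟩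
    refine ⟨h₁.anti le_sup_left, fun i j hi hj hij => ?_, fun i hi => ?_, fun i hi => ?_⟩
    · by_cases hiv : i = v
      · subst hiv; exact not_reachable_of_forall_not_adj hv hij.symm
      by_cases hjv : j = v
      · subst hjv; exact fun h => not_reachable_of_forall_not_adj hv hij h.symm
      · exact fun h => h₂ (by simp_all) (by simp_all) hij (h.mono le_sup_left)
    · by_cases hiv : i = v
      · subst hiv; simp [hHv, huv.symm, hav]
      have := h₃ (i := i) (by simp_all)
      by_cases hiu : i = u
      · subst hiu; simp; omega
      · simp [hiu]; rw [← this, hcx i hiu hiv]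
    · have hiv : i ≠ v := Finset.ne_of_mem_erase hi
      have := h₄ (Finset.mem_of_mem_erase hi)
      by_cases hiu : i = u
      · subst hiu; simp; omega
      · simp [hiu]; rw [← this, hcx i hiu hiv]
  · rintro ⟨h₁, h₂, h₃, h₄⟩
    refine ⟨h₁.sup_edge_of_not_reachable (not_reachable_of_forall_not_adj hv huv),
      fun i j hi hj hij h => ?_, fun i hi => ?_, fun i hi => ?_⟩
    · exact h₂ (by simp_all) (by simp_all) hij
        (h.of_sup_edge hv (by rintro rfl; exact hi hvS) (by rintro rfl; exact hj hvS))
    · have hiv : i ≠ v := by rintro rfl; exact hi hvS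
      have := h₃ (i := i) (by simp_all)
      by_cases hiu : i = u
      · subst hiu; simp at this; omega
      · simp [hiu] at this; rw [← this, hcx i hiu hiv]
    · by_cases hiv : i = v
      · subst hiv; omega
      have := h₄ (i := i) (by simp_all)
      by_cases hiu : i = u
      · subst hiu; simp at this; omega
      · simp [hiu] at this; rw [← this, hcx i hiu hiv]

end

namespace IsRootedForest

variable {G : SimpleGraph V} {S : Finset V} {a : V → ℕ}

open Finset in
theorem ncard_edgeSet [Fintype V] [DecidableEq V] (hG : IsRootedForest S a G)
    (ha : ∑ i, a i = #S) : G.edgeSet.ncard = #S := by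
  classical
  have h := G.sum_degrees_eq_twice_card_edges
  have hdeg : ∀ i, G.degree i = a i + if i ∈ S then 1 else 0 := fun i => by
    rw [← card_neighborSet_eq_degree, ← Nat.card_eq_fintype_card, Nat.card_coe_set_eq]
    split_ifs with hi
    · exact hG.ncard_of_mem hi
    · exact hG.ncard_of_notMem hi
  simp only [hdeg, sum_add_distrib, ha, sum_boole, filter_mem_eq_inter, univ_inter,
    Nat.cast_id] at h
  rw [← coe_edgeFinset, Set.ncard_coe_finset]
  omega

theorem exists_reachable [Fintype V] [DecidableEq V] (hG : IsRootedForest S a G)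
    (ha : ∑ i, a i = S.card) {s : V} (hs : s ∈ S) : ∃ r ∉ S, G.Reachable s r := by
  by_contra! h
  have key := hG.isAcyclic.ncard_edgeSet_add_card_le (insert s Sᶜ) (by
    intro i hi j hj hij
    rw [Finset.mem_insert, Finset.mem_compl] at hi hj
    rcases hi with rfl | hi <;> rcases hj with rfl | hj
    · exact absurd rfl hij
    · exact h j hj
    · exact fun hr => h i hi hr.symm
    · exact hG.not_reachable hi hj hij)
  rw [Finset.card_insert_of_notMem (by simpa using hs), hG.ncard_edgeSet ha,
    Finset.card_compl] at key
  have := S.card_le_univ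
  omega

theorem neighborSet_eq_singleton (hG : IsRootedForest S a G) {u v : V} (hv : v ∈ S)
    (hav : a v = 0) (hadj : G.Adj v u) : G.neighborSet v = {u} := by
  obtain ⟨w, hw⟩ := Set.ncard_eq_one.1 (show (G.neighborSet v).ncard = 1 by
    rw [hG.ncard_of_mem hv, hav])
  have : u ∈ G.neighborSet v := hadj
  rw [hw] at this ⊢
  rw [Set.mem_singleton_iff.1 this]

theorem one_le_of_adj [Fintype V] [DecidableEq V] (hG : IsRootedForest S a G)
    (ha : ∑ i, a i = S.card) {u v : V} (hv : v ∈ S) (hav : a v = 0) (hadj : G.Adj v u) :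
    1 ≤ a u := by
  by_contra! hau
  have hau : a u = 0 := by omega
  by_cases hu : u ∈ S
  · obtain ⟨r, hr, hvr⟩ := hG.exists_reachable ha hv
    have hNv := hG.neighborSet_eq_singleton hv hav hadj
    have hNu := hG.neighborSet_eq_singleton hu hau hadj.symm
    have : r ∈ ({v, u} : Set V) := hvr.mem_of_forall_adj (by
      rintro x (rfl | rfl) y hxy
      · exact Or.inr (hNv.subset hxy)
      · exact Or.inl (hNu.subset hxy)) (Or.inl rfl)
    rcases this with rfl | rfl <;> contradiction
  · have h := hG.ncard_of_notMem hu
    rw [hau, Set.ncard_eq_zero] at h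
    exact (h ▸ (show v ∈ G.neighborSet u from hadj.symm) : v ∈ (∅ : Set V))

end IsRootedForest

open Finset

open Classical in
theorem card_isRootedForest_empty [Fintype V] {a : V → ℕ} (ha : ∑ i, a i = 0) :
    #{G : SimpleGraph V | IsRootedForest ∅ a G} = 1 := by
  have ha : ∀ i, a i = 0 := by simpa using ha
  rw [card_eq_one]
  refine ⟨⊥, ?_⟩
  ext G
  simp only [mem_filter, mem_univ, true_and, mem_singleton]
  constructor
  · intro hG
    rw [eq_bot_iff_forall_not_adj]
    intro x y hxy
    have h := hG.ncard_of_notMem (notMem_empty x)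
    rw [ha, Set.ncard_eq_zero] at h
    exact (h ▸ (show y ∈ G.neighborSet x from hxy) : y ∈ (∅ : Set V))
  · rintro rfl
    exact ⟨isAcyclic_bot, fun i j _ _ hij => by simpa using hij, fun i _ => by simp [ha], by simp⟩

open Classical in
/-- Counting rooted forests by the neighbour of a fixed leaf `v`. -/
theorem card_isRootedForest_eq_sum [Fintype V] {S : Finset V} {a : V → ℕ}
    (ha : ∑ i, a i = #S) {v : V} (hv : v ∈ S) (hav : a v = 0) :
    #{G : SimpleGraph V | IsRootedForest S a G} =
      ∑ u with 1 ≤ a u, #{G : SimpleGraph V |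
        IsRootedForest (S.erase v) (Function.update a u (a u - 1)) G} := by
  have isolated : ∀ u, 1 ≤ a u → ∀ H : SimpleGraph V,
      IsRootedForest (S.erase v) (Function.update a u (a u - 1)) H → ∀ x, ¬ H.Adj v x := by
    intro u hu H hH x hx
    have huv : v ≠ u := by rintro rfl; omega
    have h := hH.ncard_of_notMem (notMem_erase v S)
    rw [Function.update_of_ne huv, hav, Set.ncard_eq_zero] at h
    exact (h ▸ (show x ∈ H.neighborSet v from hx) : x ∈ (∅ : Set V))
  rw [← card_sigma]
  symm
  refine card_bij (fun p _ => p.2 ⊔ edge v p.1) ?_ ?_ ?_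
  · rintro ⟨u, H⟩ h
    simp only [mem_sigma, mem_filter, mem_univ, true_and] at h ⊢
    exact (isRootedForest_sup_edge_iff (isolated u h.1 H h.2) hv hav h.1).2 h.2
  · rintro ⟨u, H⟩ h ⟨u', H'⟩ h' heq
    simp only [mem_sigma, mem_filter, mem_univ, true_and] at h h' heq
    have hH := isolated u h.1 H h.2
    have hH' := isolated u' h'.1 H' h'.2
    have huv : u ≠ v := by rintro rfl; omega
    have huv' : u' ≠ v := by rintro rfl; omega
    have hu : u = u' := by
      have h₁ := neighborSet_sup_edge_left (H := H) huv
      have h₂ := neighborSet_sup_edge_left (H := H') huv'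
      rw [Set.eq_empty_of_forall_notMem (s := H.neighborSet v) hH] at h₁
      rw [Set.eq_empty_of_forall_notMem (s := H'.neighborSet v) hH', ← heq, h₁] at h₂
      simpa using h₂
    subst hu
    have : H = H' := by
      ext x y
      have := congrArg (fun K : SimpleGraph V => K.Adj x y) heq
      simp only [sup_adj, edge_adj, eq_iff_iff] at this
      have h₁ := hH x
      have h₂ := hH y
      have h₃ := hH' x
      have h₄ := hH' y
      have h₅ := H.adj_comm x y
      have h₆ := H'.adj_comm x y
      grind
    rw [this]
  · intro G hG
    simp only [mem_filter, mem_univ, true_and] at hG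
    obtain ⟨u, hu⟩ := Set.ncard_eq_one.1 (show (G.neighborSet v).ncard = 1 by
      rw [hG.ncard_of_mem hv, hav])
    have hadj : G.Adj v u := by
      rw [← mem_neighborSet, hu]; rfl
    have hau := hG.one_le_of_adj ha hv hav hadj
    have hGe : G \ edge v u ⊔ edge v u = G :=
      sdiff_sup_cancel ((edge_le_iff _).2 (Or.inr hadj))
    have hiso : ∀ x, ¬ (G \ edge v u).Adj v x := by
      intro x hx
      rw [sdiff_adj, edge_adj] at hx
      have hxu : x ∈ G.neighborSet v := hx.1
      rw [hu, Set.mem_singleton_iff] at hxu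
      subst hxu
      exact hx.2 ⟨Or.inl ⟨rfl, rfl⟩, hadj.ne⟩
    refine ⟨⟨u, G \ edge v u⟩, ?_, hGe⟩
    simp only [mem_sigma, mem_filter, mem_univ, true_and]
    exact ⟨hau, (isRootedForest_sup_edge_iff hiso hv hav hau).1 (hGe.symm ▸ hG)⟩

theorem sum_update_pred [Fintype V] [DecidableEq V] {a : V → ℕ} {u : V} (hu : 1 ≤ a u) :
    ∑ i, Function.update a u (a u - 1) i = ∑ i, a i - 1 := by
  rw [sum_update_of_mem (mem_univ u), ← add_sum_erase _ a (mem_univ u), sdiff_singleton_eq_erase]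
  omega

open Classical in
theorem card_isRootedForest [Fintype V] {S : Finset V} (hS : S.Nonempty) {a : V → ℕ}
    (ha : ∑ i, a i = #S) :
    #{G : SimpleGraph V | IsRootedForest S a G} =
      ∑ l with l ∉ S ∧ 1 ≤ a l, Nat.multinomial univ (Function.update a l (a l - 1)) := by
  induction hm : #S generalizing S a with
  | zero => exact absurd (card_eq_zero.1 hm) hS.ne_empty
  | succ m ih =>
  by_cases hleaf : ∃ v ∈ S, a v = 0
  · obtain ⟨v, hv, hav⟩ := hleaf
    have hcard : #(S.erase v) = m := by rw [card_erase_of_mem hv, hm]; rfl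
    rw [card_isRootedForest_eq_sum ha hv hav]
    rcases (S.erase v).eq_empty_or_nonempty with hE | hE
    · have hm0 : m = 0 := by rw [← hcard, hE, card_empty]
      have hSv : S = {v} := by rw [← insert_erase hv, hE, insert_empty_eq]
      have hfil : ({u | 1 ≤ a u} : Finset V) = ({l | l ∉ S ∧ 1 ≤ a l} : Finset V) := by
        ext u
        simp only [mem_filter, mem_univ, true_and, hSv, mem_singleton]
        exact ⟨fun h => ⟨by rintro rfl; omega, h⟩, And.right⟩
      rw [← hfil]
      refine sum_congr rfl fun u hu => ?_
      have hsum := sum_update_pred (mem_filter.1 hu).2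
      rw [ha, hm, hm0] at hsum
      have h0 : Function.update a u (a u - 1) = 0 := by
        funext i
        exact (sum_eq_zero_iff.1 hsum) i (mem_univ i)
      rw [hE, card_isRootedForest_empty hsum, h0]
      simp [Nat.multinomial]
    · have hm0 : m ≠ 0 := by rw [← hcard]; exact hE.card_pos.ne'
      have hL : ∀ u ∈ ({u | 1 ≤ a u} : Finset V), _ := fun u hu =>
        ih hE (a := Function.update a u (a u - 1))
          (by rw [sum_update_pred (mem_filter.1 hu).2, ha, hm, hcard]; rfl) hcard
      have hR : ∀ l ∈ ({l | l ∉ S ∧ 1 ≤ a l} : Finset V), _ := fun l hl =>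
        Nat.multinomial_eq_sum_update_pred (Function.update a l (a l - 1))
          (by rw [sum_update_pred (mem_filter.1 hl).2.2, ha, hm]; exact hm0)
      rw [sum_congr rfl hL, sum_congr rfl hR]
      rw [sum_comm' (t' := ({l | l ∉ S ∧ 1 ≤ a l} : Finset V))
        (s' := fun l => {u | 1 ≤ Function.update a l (a l - 1) u})]
      · refine sum_congr rfl fun l hl => sum_congr rfl fun u hu => ?_
        congr 1
        by_cases hul : u = l
        · subst hul; rfl
        · rw [Function.update_of_ne hul, Function.update_of_ne (Ne.symm hul),
            Function.update_comm hul]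
      · intro u l
        simp only [mem_filter, mem_univ, true_and, mem_erase, Function.update_apply]
        by_cases hul : u = l
        · subst hul; grind
        · grind
  · push Not at hleaf
    have hsplit := sum_add_sum_compl S a
    have hge : #S ≤ ∑ i ∈ S, a i := by
      simpa using card_nsmul_le_sum S a 1 fun i hi => Nat.one_le_iff_ne_zero.2 (hleaf i hi)
    have hzero : ∑ i ∈ Sᶜ, a i = 0 := by omega
    have hzero : ∀ i ∉ S, a i = 0 := fun i hi =>
      (sum_eq_zero_iff.1 hzero) i (mem_compl.2 hi)
    have hroots : ({l | l ∉ S ∧ 1 ≤ a l} : Finset V) = ∅ :=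
      filter_eq_empty_iff.2 fun l _ hl => by have := hzero l hl.1; omega
    rw [hroots, sum_empty, card_eq_zero, filter_eq_empty_iff]
    intro G _ hG
    obtain ⟨s, hs⟩ := hS
    obtain ⟨r, hr, hsr⟩ := hG.exists_reachable ha hs
    have h := hG.ncard_of_notMem hr
    rw [hzero r hr, Set.ncard_eq_zero] at h
    refine not_reachable_of_forall_not_adj (v := r) (fun x hx => ?_)
      (by rintro rfl; exact hr hs) hsr.symm
    exact (h ▸ (show x ∈ G.neighborSet r from hx) : x ∈ (∅ : Set V))

end SimpleGraph


/-- let `n ≥ 1`, `1 ≤ k < n` and let `a₁,…,a_n ≥ 0` with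
`a₁+⋯+a_n = n−k`. The number of acyclic simple graphs on `{1,…,n}` in which the
vertices `1,…,k` (here: the `i : Fin n` with `i.val < k`) lie in pairwise distinct
connected components and whose degrees are `a_i` for `i ≤ k` and `a_i + 1` for
`i > k` equals `Σ_{l ≤ k, a_l ≥ 1} (n−k−1)! / ((a_l−1)!·∏_{i≠l} a_i!)`. -/
theorem stmt5 (n k : ℕ) (hn : 1 ≤ n) (hk1 : 1 ≤ k) (hkn : k < n)
    (a : Fin n → ℕ) (ha : ∑ i, a i = n - k) :
    Nat.card {G : SimpleGraph (Fin n) //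
        G.IsAcyclic ∧
        (∀ i j : Fin n, i.val < k → j.val < k → i ≠ j → ¬ G.Reachable i j) ∧
        (∀ i : Fin n, (G.neighborSet i).ncard = if i.val < k then a i else a i + 1)} =
      ∑ l ∈ Finset.univ.filter (fun l : Fin n => l.val < k ∧ 1 ≤ a l),
        Nat.multinomial Finset.univ (Function.update a l (a l - 1)) := by
  classical
  set S : Finset (Fin n) := (Finset.univ.filter fun i => i.val < k)ᶜ with hS
  have hmem : ∀ i : Fin n, i ∈ S ↔ ¬ i.val < k := by simp [hS]
  have hcard : S.card = n - k := by
    rw [hS, Finset.card_compl, Fintype.card_fin, Fin.card_filter_val_lt, min_eq_right hkn.le]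
  have hne : S.Nonempty := ⟨⟨k, hkn⟩, by simp [hS]⟩
  have key := SimpleGraph.card_isRootedForest hne (ha.trans hcard.symm)
  simp only [hmem, not_not] at key
  rw [Nat.card_congr (Equiv.subtypeEquivRight (q := SimpleGraph.IsRootedForest S a) fun G => ?_)]
  · refine ((Nat.subtype_card _ fun G => by simp).trans key).trans ?_
    refine Finset.sum_congr rfl fun l _ => ?_
    congr!
  constructor
  · rintro ⟨h₁, h₂, h₃⟩
    exact ⟨h₁, fun i j hi hj => h₂ i j (by simpa [hmem] using hi) (by simpa [hmem] using hj),
      fun i hi => by rw [h₃, if_pos (by simpa [hmem] using hi)],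
      fun i hi => by rw [h₃, if_neg ((hmem i).1 hi)]⟩
  · rintro ⟨h₁, h₂, h₃, h₄⟩
    refine ⟨h₁, fun i j hi hj => h₂ (by simpa [hmem] using hi) (by simpa [hmem] using hj),
      fun i => ?_⟩
    split_ifs with hi
    · exact h₃ (by simpa [hmem] using hi)
    · exact h₄ ((hmem i).2 hi)
end

section
/- Let m ≥ 1 and k ≥ 1 be integers and let s₁, …, s_k be positive integers. Consider all simple graphs G on the (m+k)-element vertex set {r₁,…,r_m} ∪ {t₁,…,t_k} that are acyclic, have exactly m connected components, and in which the vertices r₁, …, r_m lie in pairwise distinct connected components (so every t_p has degree at least 1). Then Σ_G ∏_{p=1}^{k} s_p^{deg_G(t_p) − 1} = Σ_{(a₁,…,a_{m+k})} Σ_l (k−1)! / ( (a_l − 1)! · ∏_{i ≠ l} a_i! ) · ∏_{p=1}^{k} s_p^{a_{m+p}}, where the outer sum on the right is over all tuples (a₁,…,a_{m+k}) of nonnegative integers with a₁+⋯+a_{m+k} = k, and the inner sum is over those l ∈ {1,…,m} with a_l ≥ 1. -/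
/-- The relation that `u` is the parent of `v` under a parent map `f` on the non-root vertices. -/
def IsParent {ρ τ : Type*} (f : τ → ρ ⊕ τ) (u v : ρ ⊕ τ) : Prop :=
  ∃ p, v = Sum.inr p ∧ u = f p

/-- The simple graph joining every non-root vertex to its parent. -/
def parentGraph {ρ τ : Type*} (f : τ → ρ ⊕ τ) : SimpleGraph (ρ ⊕ τ) :=
  SimpleGraph.fromRel (IsParent f)

section Graph

variable {ρ τ : Type*} {f : τ → ρ ⊕ τ}

theorem isParent_inr (f : τ → ρ ⊕ τ) (p : τ) : IsParent f (f p) (Sum.inr p) :=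
  ⟨p, rfl, rfl⟩

theorem not_isParent_inl (u : ρ ⊕ τ) (i : ρ) : ¬ IsParent f u (Sum.inl i) := by
  rintro ⟨p, hp, -⟩
  cases hp

theorem isParent_inr_iff {u : ρ ⊕ τ} {p : τ} : IsParent f u (Sum.inr p) ↔ u = f p := by
  constructor
  · rintro ⟨q, hq, rfl⟩
    rw [Sum.inr.inj hq]
  · rintro rfl
    exact isParent_inr f p

theorem parentGraph_adj (hf : WellFounded (IsParent f)) {u v : ρ ⊕ τ} :
    (parentGraph f).Adj u v ↔ IsParent f u v ∨ IsParent f v u := by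
  rw [parentGraph, SimpleGraph.fromRel_adj, and_iff_right_iff_imp]
  rintro h rfl
  exact hf.irrefl.irrefl _ (h.elim id id)

theorem SimpleGraph.Reachable.mem_of_forall_adj_s6 {V : Type*} {G : SimpleGraph V} {S : Set V}
    (hS : ∀ u v, G.Adj u v → u ∈ S → v ∈ S) {u v : V} (h : G.Reachable u v) (hu : u ∈ S) :
    v ∈ S := by
  rw [SimpleGraph.reachable_iff_reflTransGen] at h
  induction h with
  | refl => exact hu
  | tail _ hab ih => exact hS _ _ hab ih

theorem parentGraph_isAcyclic (hf : WellFounded (IsParent f)) : (parentGraph f).IsAcyclic := by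
  rw [SimpleGraph.isAcyclic_iff_forall_adj_isBridge]
  have key : ∀ p, (parentGraph f).IsBridge s(Sum.inr p, f p) := by
    intro p
    rw [SimpleGraph.isBridge_iff]
    intro h
    have hd : f p ∈ {v | Relation.ReflTransGen (IsParent f) (Sum.inr p) v} := by
      refine h.mem_of_forall_adj_s6 ?_ Relation.ReflTransGen.refl
      intro u v huv hu
      rw [SimpleGraph.deleteEdges_adj, parentGraph_adj hf] at huv
      obtain ⟨huv | ⟨q, rfl, rfl⟩, hne⟩ := huv
      · exact Relation.ReflTransGen.tail hu huv
      · rcases Relation.ReflTransGen.cases_tail hu with h | ⟨w, hw, hwq⟩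
        · exact absurd (by rw [Sum.inr.inj h]; rfl) hne
        · rwa [isParent_inr_iff.1 hwq] at hw
    have := Relation.TransGen.tail' hd (isParent_inr f p)
    exact hf.transGen.irrefl.irrefl _ this
  intro u v huv
  obtain ⟨q, rfl, rfl⟩ | ⟨q, rfl, rfl⟩ := (parentGraph_adj hf).1 huv
  · rw [Sym2.eq_swap]
    exact key q
  · exact key q

theorem parentGraph_not_reachable (hf : WellFounded (IsParent f)) {i j : ρ} (hij : i ≠ j) :
    ¬ (parentGraph f).Reachable (Sum.inl i) (Sum.inl j) := by
  intro h
  have hd : Sum.inl j ∈ {v | Relation.ReflTransGen (IsParent f) (Sum.inl i) v} := by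
    refine h.mem_of_forall_adj_s6 ?_ Relation.ReflTransGen.refl
    intro u v huv hu
    obtain huv | ⟨q, rfl, rfl⟩ := (parentGraph_adj hf).1 huv
    · exact Relation.ReflTransGen.tail hu huv
    · rcases Relation.ReflTransGen.cases_tail hu with h | ⟨w, hw, hwq⟩
      · cases h
      · rwa [isParent_inr_iff.1 hwq] at hw
  rcases Relation.ReflTransGen.cases_tail hd with h | ⟨w, -, hw⟩
  · exact hij (Sum.inl.inj h).symm
  · exact not_isParent_inl _ _ hw

theorem parentGraph_exists_reachable (hf : WellFounded (IsParent f)) (v : ρ ⊕ τ) :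
    ∃ i, (parentGraph f).Reachable (Sum.inl i) v := by
  induction v using hf.induction with
  | _ v ih =>
    cases v with
    | inl i => exact ⟨i, .refl _⟩
    | inr p =>
      obtain ⟨i, hi⟩ := ih _ (isParent_inr f p)
      exact ⟨i, hi.trans ((parentGraph_adj hf).2 (.inl (isParent_inr f p))).reachable⟩

theorem parentGraph_injOn :
    Set.InjOn (parentGraph : (τ → ρ ⊕ τ) → _) {f | WellFounded (IsParent f)} := by
  intro f (hf : WellFounded _) g (hg : WellFounded _) hfg
  have key : ∀ v : ρ ⊕ τ, ∀ p, v = Sum.inr p → g p = f p := by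
    intro v
    induction v using WellFounded.induction hf with
    | _ v ih =>
      rintro p rfl
      have hadj := (parentGraph_adj hf).2 (.inl (isParent_inr f p))
      rw [hfg, parentGraph_adj hg] at hadj
      obtain h | ⟨q, hq, hpq⟩ := hadj
      · exact (isParent_inr_iff.1 h).symm
      · have hgq := ih _ (isParent_inr f p) q hq
        have h1 : IsParent f (Sum.inr p) (f p) := by
          rw [hq, isParent_inr_iff, ← hgq, hpq]
        exact absurd (isParent_inr f p) (hf.asymmetric _ _ h1)
  exact funext fun p => (key _ p rfl).symm

/-- A forest in which every vertex is connected to exactly one root comes from a parent map. -/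
theorem exists_parentGraph_eq {G : SimpleGraph (ρ ⊕ τ)} (hG : G.IsAcyclic)
    (hroot : ∀ v, ∃ i, G.Reachable (Sum.inl i) v)
    (hne : ∀ i j : ρ, i ≠ j → ¬ G.Reachable (Sum.inl i) (Sum.inl j)) :
    ∃ f, WellFounded (IsParent f) ∧ parentGraph f = G := by
  choose r hr using hroot
  have hr_eq : ∀ {u v}, G.Reachable u v → r u = r v := by
    intro u v huv
    by_contra h
    exact hne _ _ h (((hr u).trans huv).trans (hr v).symm)
  have hstep : ∀ p : τ, ∃ u, G.Adj (Sum.inr p) u ∧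
      G.dist u (Sum.inl (r u)) < G.dist (Sum.inr p) (Sum.inl (r (Sum.inr p))) := by
    intro p
    obtain ⟨w, hw⟩ := (hr (Sum.inr p)).symm.exists_walk_length_eq_dist
    cases w with
    | cons h w =>
      refine ⟨_, h, ?_⟩
      rw [← hr_eq h.reachable, ← hw, SimpleGraph.Walk.length_cons, Nat.lt_succ_iff]
      exact SimpleGraph.dist_le w
  choose f hadj hlt using hstep
  have hf : WellFounded (IsParent f) := by
    refine Subrelation.wf ?_ (measure fun v => G.dist v (Sum.inl (r v))).wf
    rintro u v ⟨p, rfl, rfl⟩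
    exact hlt p
  have hle : parentGraph f ≤ G := by
    intro u v huv
    obtain ⟨q, rfl, rfl⟩ | ⟨q, rfl, rfl⟩ := (parentGraph_adj hf).1 huv
    · exact (hadj q).symm
    · exact hadj q
  refine ⟨f, hf, le_antisymm hle fun u v huv => ?_⟩
  by_contra hnot
  have hbr := SimpleGraph.isAcyclic_iff_forall_adj_isBridge.1 hG huv
  rw [SimpleGraph.isBridge_iff] at hbr
  apply hbr
  have hle' : parentGraph f ≤ G.deleteEdges {s(u, v)} := by
    intro a b hab
    rw [SimpleGraph.deleteEdges_adj]
    refine ⟨hle hab, fun h => hnot ?_⟩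
    rw [← SimpleGraph.mem_edgeSet] at hab ⊢
    rwa [← Set.mem_singleton_iff.1 h]
  refine SimpleGraph.Reachable.mono hle' ?_
  obtain ⟨i, hi⟩ := parentGraph_exists_reachable hf u
  obtain ⟨j, hj⟩ := parentGraph_exists_reachable hf v
  have hij : i = j := by
    by_contra h
    exact hne i j h (((hi.mono hle).trans huv.reachable).trans (hj.mono hle).symm)
  subst hij
  exact hi.symm.trans hj

theorem SimpleGraph.exists_reachable_of_card_connectedComponent {V ι : Type*} [Finite V]
    [Finite ι] {G : SimpleGraph V} {r : ι → V} (hcard : Nat.card G.ConnectedComponent = Nat.card ι)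
    (hne : ∀ i j, i ≠ j → ¬ G.Reachable (r i) (r j)) (v : V) :
    ∃ i, G.Reachable (r i) v := by
  have hinj : Function.Injective fun i => G.connectedComponentMk (r i) := fun i j h => by
    by_contra hij
    exact hne i j hij (SimpleGraph.ConnectedComponent.eq.1 h)
  obtain ⟨i, hi⟩ := (hinj.bijective_of_nat_card_le hcard.le).2 (G.connectedComponentMk v)
  exact ⟨i, SimpleGraph.ConnectedComponent.eq.1 hi⟩

theorem SimpleGraph.card_connectedComponent_eq {V ι : Type*}
    {G : SimpleGraph V} {r : ι → V} (hex : ∀ v, ∃ i, G.Reachable (r i) v)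
    (hne : ∀ i j, i ≠ j → ¬ G.Reachable (r i) (r j)) :
    Nat.card G.ConnectedComponent = Nat.card ι := by
  refine (Nat.card_congr (Equiv.ofBijective (fun i => G.connectedComponentMk (r i))
    ⟨fun i j h => ?_, fun c => ?_⟩)).symm
  · by_contra hij
    exact hne i j hij (SimpleGraph.ConnectedComponent.eq.1 h)
  · induction c using SimpleGraph.ConnectedComponent.ind with
    | _ v =>
      obtain ⟨i, hi⟩ := hex v
      exact ⟨i, SimpleGraph.ConnectedComponent.eq.2 hi⟩

theorem parentGraph_neighborSet (hf : WellFounded (IsParent f)) (p : τ) :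
    (parentGraph f).neighborSet (Sum.inr p) =
      insert (f p) (Sum.inr '' {q | f q = Sum.inr p}) := by
  ext v
  rw [SimpleGraph.mem_neighborSet, SimpleGraph.adj_comm, parentGraph_adj hf, isParent_inr_iff]
  simp only [IsParent, Set.mem_insert_iff, Set.mem_image, Set.mem_ofPred_eq]
  grind

open scoped Classical in
theorem parentGraph_ncard_neighborSet [Fintype τ] (hf : WellFounded (IsParent f)) (p : τ) :
    ((parentGraph f).neighborSet (Sum.inr p)).ncard =
      (Finset.univ.filter fun q => f q = Sum.inr p).card + 1 := by
  rw [parentGraph_neighborSet hf, Set.ncard_insert_of_notMem,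
    Set.ncard_image_of_injective _ Sum.inr_injective, ← Set.ncard_coe_finset]
  · simp
  · rintro ⟨q, hq, hqp⟩
    have h1 : IsParent f (Sum.inr p) (f p) := by
      rw [← hqp, isParent_inr_iff, hq]
    exact hf.asymmetric _ _ h1 (isParent_inr f p)

open scoped Classical in
theorem prod_pow_ncard_neighborSet_sub_one [Fintype τ] {R : Type*} [CommMonoid R] (s : τ → R)
    (hf : WellFounded (IsParent f)) :
    ∏ p, s p ^ (((parentGraph f).neighborSet (Sum.inr p)).ncard - 1) =
      ∏ q, Sum.elim (fun _ => 1) s (f q) := by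
  have h : ∀ q, Sum.elim (fun _ => 1) s (f q) = ∏ p, if f q = Sum.inr p then s p else 1 := by
    intro q
    cases f q <;> simp
  simp_rw [h, parentGraph_ncard_neighborSet hf, Nat.add_sub_cancel]
  rw [Finset.prod_comm]
  refine Finset.prod_congr rfl fun p _ => ?_
  rw [Finset.prod_ite, Finset.prod_const, Finset.prod_const_one, mul_one]

open scoped Classical in
theorem sum_forests_eq_sum_parent_maps [Fintype ρ] [Fintype τ] [DecidableEq ρ] [DecidableEq τ]
    {R : Type*} [CommSemiring R] (s : τ → R) :
    ∑ G ∈ Finset.univ.filter (fun G : SimpleGraph (ρ ⊕ τ) =>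
        G.IsAcyclic ∧ Nat.card G.ConnectedComponent = Nat.card ρ ∧
        ∀ p q : ρ, p ≠ q → ¬ G.Reachable (Sum.inl p) (Sum.inl q)),
      ∏ p, s p ^ ((G.neighborSet (Sum.inr p)).ncard - 1) =
    ∑ f ∈ Finset.univ.filter (fun f : τ → ρ ⊕ τ => WellFounded (IsParent f)),
      ∏ q, Sum.elim (fun _ => 1) s (f q) := by
  symm
  refine Finset.sum_bij (fun f _ => parentGraph f) ?_ ?_ ?_ ?_
  · intro f hf
    have hf := (Finset.mem_filter.1 hf).2
    exact Finset.mem_filter.2 ⟨Finset.mem_univ _, parentGraph_isAcyclic hf,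
      SimpleGraph.card_connectedComponent_eq (parentGraph_exists_reachable hf)
        fun _ _ => parentGraph_not_reachable hf, fun _ _ => parentGraph_not_reachable hf⟩
  · intro f hf g hg h
    exact parentGraph_injOn (Finset.mem_filter.1 hf).2 (Finset.mem_filter.1 hg).2 h
  · intro G hG
    obtain ⟨-, hac, hcard, hne⟩ := Finset.mem_filter.1 hG
    obtain ⟨f, hf, rfl⟩ := exists_parentGraph_eq hac
      (SimpleGraph.exists_reachable_of_card_connectedComponent hcard hne) hne
    exact ⟨f, Finset.mem_filter.2 ⟨Finset.mem_univ _, hf⟩, rfl⟩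
  · intro f hf
    exact (prod_pow_ncard_neighborSet_sub_one s (Finset.mem_filter.1 hf).2).symm

end Graph

section Determinant

variable {ρ τ : Type*} [DecidableEq τ]

/-- The row `e_p - e_v` of a reduced Laplacian, where `e_v = 0` for a root `v`. -/
def laplacianRow (p : τ) (v : ρ ⊕ τ) : τ → ℤ :=
  Pi.single p 1 - Sum.elim (fun _ => 0) (fun q => Pi.single q 1) v

open scoped Classical in
theorem det_laplacianRow [Fintype τ] (f : τ → ρ ⊕ τ) :
    (Matrix.of fun p => laplacianRow p (f p)).det = if WellFounded (IsParent f) then 1 else 0 := by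
  have hentry : ∀ p q, laplacianRow p (f p) q =
      (if p = q then 1 else 0) - if f p = Sum.inr q then 1 else 0 := by
    intro p q
    cases h : f p <;> simp [laplacianRow, Pi.single_apply, eq_comm]
  split_ifs with hf
  · have : IsWellFounded _ (IsParent f) := ⟨hf⟩
    let d : τ → (Ordinal)ᵒᵈ := fun p => OrderDual.toDual (IsWellFounded.rank (IsParent f) (Sum.inr p))
    have hlt : ∀ p q, f p = Sum.inr q → d p < d q := by
      intro p q h
      exact IsWellFounded.rank_lt_of_rel ⟨p, rfl, h.symm⟩
    have htri : (Matrix.of fun p => laplacianRow p (f p)).BlockTriangular d := by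
      intro p q hqp
      rw [Matrix.of_apply, hentry, if_neg, if_neg, sub_zero]
      · exact fun h => lt_asymm hqp (hlt p q h)
      · rintro rfl
        exact lt_irrefl _ hqp
    rw [htri.det]
    refine Finset.prod_eq_one fun a _ => ?_
    have : (Matrix.of fun p => laplacianRow p (f p)).toSquareBlock d a = 1 := by
      ext p q
      rw [Matrix.toSquareBlock_def, Matrix.of_apply, Matrix.of_apply, hentry,
        if_neg fun h => (hlt _ _ h).ne (p.2.trans q.2.symm), sub_zero, Matrix.one_apply]
      simp only [Subtype.ext_iff]
    rw [this, Matrix.det_one]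
  · rw [← Matrix.exists_mulVec_eq_zero_iff]
    have hacc : ∀ p, Acc (IsParent f) (Sum.inr p) ↔ Acc (IsParent f) (f p) := by
      refine fun p => ⟨fun h => h.inv ⟨p, rfl, rfl⟩, fun h => ⟨_, ?_⟩⟩
      rintro _ ⟨q, hq, rfl⟩
      rwa [← Sum.inr.inj hq]
    have hinl : ∀ i, Acc (IsParent f) (Sum.inl i) := by
      refine fun i => ⟨_, ?_⟩
      rintro _ ⟨q, hq, -⟩
      cases hq
    refine ⟨fun p => if Acc (IsParent f) (Sum.inr p) then 0 else 1, ?_, ?_⟩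
    · intro h
      refine hf ⟨fun v => ?_⟩
      cases v with
      | inl i => exact hinl i
      | inr p =>
        by_contra hp
        simpa [hp] using congrFun h p
    · ext p
      simp only [Matrix.mulVec, dotProduct, Matrix.of_apply, hentry, sub_mul, ite_mul, one_mul,
        zero_mul, Finset.sum_sub_distrib, Finset.sum_ite_eq, Finset.mem_univ, if_true, hacc p]
      cases h : f p with
      | inl i => simp [hinl]
      | inr q => simp

open scoped Classical in
/-- The weighted count of rooted forests, each vertex `v` being weighted by `x v` to the power of
its number of children. -/
theorem sum_wellFounded_isParent [Fintype ρ] [Fintype τ] [Nonempty τ] (x : ρ ⊕ τ → ℤ) :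
    ∑ f ∈ Finset.univ.filter (fun f : τ → ρ ⊕ τ => WellFounded (IsParent f)), ∏ q, x (f q) =
      (∑ i, x (Sum.inl i)) * (∑ v, x v) ^ (Fintype.card τ - 1) := by
  have hdet : (Matrix.of fun p => ∑ v, x v • laplacianRow (ρ := ρ) p v).det =
      ∑ f : τ → ρ ⊕ τ, (∏ q, x (f q)) * if WellFounded (IsParent f) then 1 else 0 := by
    have h := (Matrix.detRowAlternating (n := τ) (R := ℤ)).toMultilinearMap.map_sum
      fun p (v : ρ ⊕ τ) => x v • laplacianRow p v
    refine h.trans (Finset.sum_congr rfl fun f _ => ?_)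
    rw [← det_laplacianRow]
    exact MultilinearMap.map_smul_univ _ _ _
  have hmat : (Matrix.of fun p => ∑ v, x v • laplacianRow (ρ := ρ) p v) =
      Matrix.scalar τ (∑ v, x v) - Matrix.vecMulVec (fun _ => 1) fun q => x (Sum.inr q) := by
    ext p q
    rw [Matrix.sub_apply, Matrix.scalar_apply, Matrix.diagonal_apply, Matrix.vecMulVec_apply]
    by_cases h : p = q <;>
      simp [laplacianRow, Pi.single_apply, mul_sub, Finset.sum_sub_distrib, h, eq_comm (a := q)]
  rw [hmat, ← Matrix.eval_charpoly, Matrix.charpoly_vecMulVec] at hdet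
  simp only [mul_ite, mul_one, mul_zero, ← Finset.sum_filter] at hdet
  rw [← hdet]
  obtain ⟨n, hn⟩ := Nat.exists_eq_succ_of_ne_zero (Fintype.card_ne_zero (α := τ))
  simp only [Polynomial.eval_sub, Polynomial.eval_smul, Polynomial.eval_pow, Polynomial.eval_X,
    smul_eq_mul, Fintype.sum_sum_type, dotProduct, one_mul, hn, Nat.succ_sub_one]
  rw [pow_succ]
  ring

end Determinant

theorem sum_antidiagonalTuple_multinomial_update (n k : ℕ) (hk : 1 ≤ k) (l : Fin n)
    (x : Fin n → ℕ) (hx : x l = 1) :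
    ∑ a ∈ (Finset.Nat.antidiagonalTuple n k).filter (fun a => 1 ≤ a l),
      Nat.multinomial Finset.univ (Function.update a l (a l - 1)) * ∏ i, x i ^ a i =
    (∑ i, x i) ^ (k - 1) := by
  rw [Finset.sum_pow_eq_sum_piAntidiag]
  refine Finset.sum_bij' (fun a _ => Function.update a l (a l - 1))
    (fun b _ => Function.update b l (b l + 1)) ?_ ?_ ?_ ?_ ?_
  · intro a ha
    obtain ⟨h, hl⟩ := Finset.mem_filter.1 ha
    rw [Finset.Nat.mem_antidiagonalTuple, ← Finset.add_sum_erase _ _ (Finset.mem_univ l)] at h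
    rw [Finset.mem_piAntidiag, ← Finset.add_sum_erase _ _ (Finset.mem_univ l),
      Finset.sum_congr rfl fun i hi => Function.update_of_ne (Finset.ne_of_mem_erase hi) _ _,
      Function.update_self]
    exact ⟨by omega, by simp⟩
  · intro b hb
    have h := (Finset.mem_piAntidiag.1 hb).1
    rw [← Finset.add_sum_erase _ _ (Finset.mem_univ l)] at h
    rw [Finset.mem_filter, Finset.Nat.mem_antidiagonalTuple,
      ← Finset.add_sum_erase _ _ (Finset.mem_univ l),
      Finset.sum_congr rfl fun i hi => Function.update_of_ne (Finset.ne_of_mem_erase hi) _ _,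
      Function.update_self]
    exact ⟨by omega, by omega⟩
  · intro a ha
    simp [Nat.sub_add_cancel (Finset.mem_filter.1 ha).2]
  · intro b _
    simp
  · intro a _
    push_cast
    congr 1
    refine Finset.prod_congr rfl fun i _ => ?_
    by_cases h : i = l
    · subst h
      simp [hx]
    · rw [Function.update_of_ne h]

theorem sum_antidiagonalTuple_sum_multinomial (m k : ℕ) (hk : 1 ≤ k) (s : Fin k → ℕ) :
    ∑ a ∈ Finset.Nat.antidiagonalTuple (m + k) k,
      ∑ l ∈ Finset.univ.filter (fun l : Fin (m + k) => l.val < m ∧ 1 ≤ a l),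
        Nat.multinomial Finset.univ (Function.update a l (a l - 1)) *
          ∏ p : Fin k, s p ^ a (Fin.natAdd m p) = m * (m + ∑ p, s p) ^ (k - 1) := by
  simp_rw [← Finset.filter_filter, Finset.sum_filter (fun l => 1 ≤ _)]
  rw [Finset.sum_comm]
  simp_rw [← Finset.sum_filter]
  have h : ∀ l ∈ Finset.univ.filter (fun l : Fin (m + k) => l.val < m),
      ∑ a ∈ (Finset.Nat.antidiagonalTuple (m + k) k).filter (fun a => 1 ≤ a l),
        Nat.multinomial Finset.univ (Function.update a l (a l - 1)) *
          ∏ p : Fin k, s p ^ a (Fin.natAdd m p) = (m + ∑ p, s p) ^ (k - 1) := by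
    intro l hl
    have hx : (Fin.append (fun _ : Fin m => 1) s) l = 1 := by
      exact Fin.append_left (fun _ : Fin m => 1) s ⟨l, (Finset.mem_filter.1 hl).2⟩
    simpa [Fin.prod_univ_add, Fin.sum_univ_add] using
      sum_antidiagonalTuple_multinomial_update (m + k) k hk l _ hx
  rw [Finset.sum_congr rfl h, Finset.sum_const, smul_eq_mul]
  congr 1
  rw [Fin.card_filter_val_lt]
  omega

open scoped Classical in
/-- for `m, k ≥ 1` and positive integers `s₁,…,s_k`, summing
`∏_p s_p^(deg(t_p) − 1)` over all acyclic simple graphs on the vertex set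
`{r₁,…,r_m} ⊔ {t₁,…,t_k}` with exactly `m` connected components in which the `r`'s
lie in pairwise distinct components gives
`Σ_{a : a₁+⋯+a_{m+k} = k} Σ_{l ≤ m, a_l ≥ 1} (k−1)!/((a_l−1)!·∏_{i≠l} a_i!) · ∏_p s_p^{a_{m+p}}`. -/
theorem stmt6 (m k : ℕ) (hm : 1 ≤ m) (hk : 1 ≤ k)
    (s : Fin k → ℕ) (hs : ∀ p, 0 < s p) :
    ∑ G ∈ Finset.univ.filter (fun G : SimpleGraph (Fin m ⊕ Fin k) =>
        G.IsAcyclic ∧ Nat.card G.ConnectedComponent = m ∧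
        ∀ p q : Fin m, p ≠ q → ¬ G.Reachable (Sum.inl p) (Sum.inl q)),
      ∏ p : Fin k, s p ^ ((G.neighborSet (Sum.inr p)).ncard - 1) =
    ∑ a ∈ Finset.Nat.antidiagonalTuple (m + k) k,
      ∑ l ∈ Finset.univ.filter (fun l : Fin (m + k) => l.val < m ∧ 1 ≤ a l),
        Nat.multinomial Finset.univ (Function.update a l (a l - 1)) *
          ∏ p : Fin k, s p ^ a (Fin.natAdd m p) := by
  have hroots := sum_forests_eq_sum_parent_maps (ρ := Fin m) s
  rw [Nat.card_fin] at hroots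
  rw [sum_antidiagonalTuple_sum_multinomial m k hk]
  have : Nonempty (Fin k) := ⟨⟨0, hk⟩⟩
  have h := sum_wellFounded_isParent
    (Sum.elim (fun _ : Fin m => 1) fun p : Fin k => (s p : ℤ))
  have hcast : ∀ v : Fin m ⊕ Fin k,
      Sum.elim (fun _ => 1) (fun p => (s p : ℤ)) v = (Sum.elim (fun _ => 1) s v : ℕ) := by
    rintro (i | p) <;> simp
  simp only [Fintype.sum_sum_type, Sum.elim_inl, Sum.elim_inr, Finset.sum_const,
    Finset.card_univ, Fintype.card_fin, nsmul_eq_mul, mul_one] at h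
  simp only [hcast] at h
  norm_cast at h
  convert hroots.trans h
end
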